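/- Let (A, μ, Δ, α, r) be a coboundary infinitesimal Hom-bialgebra. Then for each integer n ≥ 0, Aⁿ = (A, μ⁽ⁿ⁾, Δ⁽ⁿ⁾, α^{2ⁿ}, r) is also a coboundary infinitesimal Hom-bialgebra, where μ⁽ⁿ⁾ = α^{2ⁿ−1}∘μ and Δ⁽ⁿ⁾ = Δ∘α^{2ⁿ−1}. -/

import Mathlib

open TensorProduct

noncomputable section

variable {k : Type*} [Field k] {A : Type*} [AddCommGroup A] [Module k A]

/-- `(A, μ, α)` is a Hom-associative algebra: multiplicativity and Hom-associativity. -/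
def IsHomAssociative (μ : A ⊗[k] A →ₗ[k] A) (α : A →ₗ[k] A) : Prop :=
  (∀ x y : A, α (μ (x ⊗ₜ y)) = μ (α x ⊗ₜ α y)) ∧
  (∀ x y z : A, μ (α x ⊗ₜ μ (y ⊗ₜ z)) = μ (μ (x ⊗ₜ y) ⊗ₜ α z))

/-- `(A, Δ, α)` is a Hom-coassociative coalgebra: comultiplicativity and
Hom-coassociativity (the latter via the associator). -/
def IsHomCoassociative (Δ : A →ₗ[k] A ⊗[k] A) (α : A →ₗ[k] A) : Prop :=
  (∀ a : A, Δ (α a) = TensorProduct.map α α (Δ a)) ∧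
  (∀ a : A, TensorProduct.map α Δ (Δ a)
      = TensorProduct.assoc k A A A (TensorProduct.map Δ α (Δ a)))

/-- The cocycle condition `Δ∘μ = (μ⊗α)∘(α⊗Δ) + (α⊗μ)∘(Δ⊗α)`. -/
def IsCocycle (μ : A ⊗[k] A →ₗ[k] A) (Δ : A →ₗ[k] A ⊗[k] A) (α : A →ₗ[k] A) : Prop :=
  ∀ a b : A,
    Δ (μ (a ⊗ₜ b)) =
      TensorProduct.map μ α ((TensorProduct.assoc k A A A).symm (α a ⊗ₜ Δ b)) +
      TensorProduct.map α μ (TensorProduct.assoc k A A A (Δ a ⊗ₜ α b))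

/-- Infinitesimal Hom-bialgebra. -/
def IsInfHomBialgebra (μ : A ⊗[k] A →ₗ[k] A) (Δ : A →ₗ[k] A ⊗[k] A)
    (α : A →ₗ[k] A) : Prop :=
  IsHomAssociative μ α ∧ IsHomCoassociative Δ α ∧ IsCocycle μ Δ α

/-- `[a, -]_*` : sends `Σ b₁⊗b₂` to `Σ μ(a,b₁)⊗α(b₂) − α(b₁)⊗μ(b₂,a)`. -/
def starBracket (μ : A ⊗[k] A →ₗ[k] A) (α : A →ₗ[k] A) (a : A) :
    A ⊗[k] A →ₗ[k] A ⊗[k] A :=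
  TensorProduct.map (μ ∘ₗ TensorProduct.mk k A A a) α
    - TensorProduct.map α (μ ∘ₗ (TensorProduct.mk k A A).flip a)

/-- Coboundary infinitesimal Hom-bialgebra: an infinitesimal Hom-bialgebra with an
`α`-invariant `r` such that `Δ = [-, r]_*`. -/
def IsCoboundary (μ : A ⊗[k] A →ₗ[k] A) (Δ : A →ₗ[k] A ⊗[k] A) (α : A →ₗ[k] A)
    (r : A ⊗[k] A) : Prop :=
  IsInfHomBialgebra μ Δ α ∧ TensorProduct.map α α r = r ∧
    ∀ a : A, Δ a = starBracket μ α a r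

/-- `[a, -]_•` on 2-tensors: `Σ μ(α(a),b₁)⊗α(b₂) − α(b₁)⊗μ(b₂,α(a))`. -/
def dotBracket2 (μ : A ⊗[k] A →ₗ[k] A) (α : A →ₗ[k] A) (a : A) :
    A ⊗[k] A →ₗ[k] A ⊗[k] A :=
  TensorProduct.map (μ ∘ₗ TensorProduct.mk k A A (α a)) α
    - TensorProduct.map α (μ ∘ₗ (TensorProduct.mk k A A).flip (α a))

/-- `[a, -]_•` on 3-tensors: `Σ μ(α(a),b₁)⊗α(b₂)⊗α(b₃) − α(b₁)⊗α(b₂)⊗μ(b₃,α(a))`. -/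
def dotBracket3 (μ : A ⊗[k] A →ₗ[k] A) (α : A →ₗ[k] A) (a : A) :
    A ⊗[k] (A ⊗[k] A) →ₗ[k] A ⊗[k] (A ⊗[k] A) :=
  TensorProduct.map (μ ∘ₗ TensorProduct.mk k A A (α a)) (TensorProduct.map α α)
    - TensorProduct.map α
        (TensorProduct.map α (μ ∘ₗ (TensorProduct.mk k A A).flip (α a)))

/-- `(r, s) ↦ r₁₃s₁₂ = Σ μ(uᵢ,uⱼ')⊗α(vⱼ')⊗α(vᵢ)` for `r = Σ uᵢ⊗vᵢ`, `s = Σ uⱼ'⊗vⱼ'`. -/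
def t13_12 (μ : A ⊗[k] A →ₗ[k] A) (α : A →ₗ[k] A) :
    (A ⊗[k] A) ⊗[k] (A ⊗[k] A) →ₗ[k] A ⊗[k] (A ⊗[k] A) :=
  TensorProduct.map μ
      (TensorProduct.map α α ∘ₗ (TensorProduct.comm k A A).toLinearMap)
    ∘ₗ (TensorProduct.tensorTensorTensorComm k A A A A).toLinearMap

/-- `(r, s) ↦ r₁₂s₂₃ = Σ α(uᵢ)⊗μ(vᵢ,uⱼ')⊗α(vⱼ')`. -/
def t12_23 (μ : A ⊗[k] A →ₗ[k] A) (α : A →ₗ[k] A) :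
    (A ⊗[k] A) ⊗[k] (A ⊗[k] A) →ₗ[k] A ⊗[k] (A ⊗[k] A) :=
  TensorProduct.map α
      (TensorProduct.map μ α ∘ₗ (TensorProduct.assoc k A A A).symm.toLinearMap)
    ∘ₗ (TensorProduct.assoc k A A (A ⊗[k] A)).toLinearMap

/-- `(r, s) ↦ r₂₃s₁₃ = Σ α(uⱼ')⊗α(uᵢ)⊗μ(vᵢ,vⱼ')`. -/
def t23_13 (μ : A ⊗[k] A →ₗ[k] A) (α : A →ₗ[k] A) :
    (A ⊗[k] A) ⊗[k] (A ⊗[k] A) →ₗ[k] A ⊗[k] (A ⊗[k] A) :=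
  (TensorProduct.assoc k A A A).toLinearMap
    ∘ₗ TensorProduct.map
        (TensorProduct.map α α ∘ₗ (TensorProduct.comm k A A).toLinearMap) μ
    ∘ₗ (TensorProduct.tensorTensorTensorComm k A A A A).toLinearMap

/-- `A(r) = r₁₃r₁₂ − r₁₂r₂₃ + r₂₃r₁₃`. -/
def Atensor (μ : A ⊗[k] A →ₗ[k] A) (α : A →ₗ[k] A) (r : A ⊗[k] A) :
    A ⊗[k] (A ⊗[k] A) :=
  t13_12 μ α (r ⊗ₜ r) - t12_23 μ α (r ⊗ₜ r) + t23_13 μ α (r ⊗ₜ r)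

/-- Quasi-triangular infinitesimal Hom-bialgebra: coboundary with `A(r) = 0`. -/
def IsQuasiTriangular (μ : A ⊗[k] A →ₗ[k] A) (Δ : A →ₗ[k] A ⊗[k] A) (α : A →ₗ[k] A)
    (r : A ⊗[k] A) : Prop :=
  IsCoboundary μ Δ α r ∧ Atensor μ α r = 0

/-- The balanceator `B(x,y) = [x, Δᵒᵖ(y)]_• + τ([y, Δᵒᵖ(x)]_•)`. -/
def balanceator (μ : A ⊗[k] A →ₗ[k] A) (Δ : A →ₗ[k] A ⊗[k] A) (α : A →ₗ[k] A)
    (x y : A) : A ⊗[k] A :=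
  dotBracket2 μ α x (TensorProduct.comm k A A (Δ y))
    + TensorProduct.comm k A A (dotBracket2 μ α y (TensorProduct.comm k A A (Δ x)))

/-- `ad_x` on 2-tensors, for a bilinear bracket `br`:
`y₁⊗y₂ ↦ [x,y₁]⊗α(y₂) + α(y₁)⊗[x,y₂]`. -/
def adMap (br : A →ₗ[k] A →ₗ[k] A) (α : A →ₗ[k] A) (x : A) :
    A ⊗[k] A →ₗ[k] A ⊗[k] A :=
  TensorProduct.map (br x) α + TensorProduct.map α (br x)

/-- Cyclic rotation on triple tensors: `x⊗y⊗z ↦ y⊗z⊗x`. -/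
def cyc3 : A ⊗[k] (A ⊗[k] A) →ₗ[k] A ⊗[k] (A ⊗[k] A) :=
  (TensorProduct.assoc k A A A).toLinearMap
    ∘ₗ (TensorProduct.comm k A (A ⊗[k] A)).toLinearMap

/-- Hom-Lie bialgebra: Hom-Lie algebra, Hom-Lie coalgebra, and the cocycle
compatibility `δ([x,y]) = ad_{α(x)}(δ(y)) − ad_{α(y)}(δ(x))`. -/
def IsHomLieBialgebra (br : A →ₗ[k] A →ₗ[k] A) (δ : A →ₗ[k] A ⊗[k] A)
    (α : A →ₗ[k] A) : Prop :=
  (∀ x y : A, br x y = - br y x) ∧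
  (∀ x y : A, α (br x y) = br (α x) (α y)) ∧
  (∀ x y z : A, br (br x y) (α z) + br (br z x) (α y) + br (br y z) (α x) = 0) ∧
  (∀ x : A, δ (α x) = TensorProduct.map α α (δ x)) ∧
  (∀ x : A, TensorProduct.comm k A A (δ x) = - δ x) ∧
  (∀ x : A, TensorProduct.map α δ (δ x) + cyc3 (TensorProduct.map α δ (δ x))
      + cyc3 (cyc3 (TensorProduct.map α δ (δ x))) = 0) ∧
  (∀ x y : A, δ (br x y) = adMap br α (α x) (δ y) - adMap br α (α y) (δ x))

/-- The commutator bracket of `μ`, as a bilinear map. -/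
def commBracket (μ : A ⊗[k] A →ₗ[k] A) : A →ₗ[k] A →ₗ[k] A :=
  TensorProduct.curry μ - (TensorProduct.curry μ).flip

/-- The cocommutator cobracket `(Id − τ)∘Δ`. -/
def cobracket (Δ : A →ₗ[k] A ⊗[k] A) : A →ₗ[k] A ⊗[k] A :=
  Δ - (TensorProduct.comm k A A).toLinearMap ∘ₗ Δ

/-- `(r, s) ↦ [r₁₂, s₁₃] = Σ β(uᵢ⊗uⱼ')⊗α(vᵢ)⊗α(vⱼ')` for a bracket `β`. -/
def c12_13 (β : A ⊗[k] A →ₗ[k] A) (α : A →ₗ[k] A) :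
    (A ⊗[k] A) ⊗[k] (A ⊗[k] A) →ₗ[k] A ⊗[k] (A ⊗[k] A) :=
  TensorProduct.map β (TensorProduct.map α α)
    ∘ₗ (TensorProduct.tensorTensorTensorComm k A A A A).toLinearMap

/-- `(r, s) ↦ [r₁₂, s₂₃] = Σ α(uᵢ)⊗β(vᵢ⊗uⱼ')⊗α(vⱼ')`. -/
def c12_23 (β : A ⊗[k] A →ₗ[k] A) (α : A →ₗ[k] A) :
    (A ⊗[k] A) ⊗[k] (A ⊗[k] A) →ₗ[k] A ⊗[k] (A ⊗[k] A) :=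
  TensorProduct.map α
      (TensorProduct.map β α ∘ₗ (TensorProduct.assoc k A A A).symm.toLinearMap)
    ∘ₗ (TensorProduct.assoc k A A (A ⊗[k] A)).toLinearMap

/-- `(r, s) ↦ [r₁₃, s₂₃] = Σ α(uᵢ)⊗α(uⱼ')⊗β(vᵢ⊗vⱼ')`. -/
def c13_23 (β : A ⊗[k] A →ₗ[k] A) (α : A →ₗ[k] A) :
    (A ⊗[k] A) ⊗[k] (A ⊗[k] A) →ₗ[k] A ⊗[k] (A ⊗[k] A) :=
  (TensorProduct.assoc k A A A).toLinearMap
    ∘ₗ TensorProduct.map (TensorProduct.map α α) β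
    ∘ₗ (TensorProduct.tensorTensorTensorComm k A A A A).toLinearMap

/-- `C(r) = [r₁₂,r₁₃] + [r₁₂,r₂₃] + [r₁₃,r₂₃]` for a bracket `β`. -/
def Ctensor (β : A ⊗[k] A →ₗ[k] A) (α : A →ₗ[k] A) (r : A ⊗[k] A) :
    A ⊗[k] (A ⊗[k] A) :=
  c12_13 β α (r ⊗ₜ r) + c12_23 β α (r ⊗ₜ r) + c13_23 β α (r ⊗ₜ r)

section Twisting

variable {μ : A ⊗[k] A →ₗ[k] A} {Δ : A →ₗ[k] A ⊗[k] A} {α β : A →ₗ[k] A}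

theorem IsHomAssociative.twist (h : IsHomAssociative μ α)
    (hαβ : ∀ x, α (β x) = β (α x)) (hμ : ∀ x y, β (μ (x ⊗ₜ y)) = μ (β x ⊗ₜ β y)) :
    IsHomAssociative (β ∘ₗ μ) (β ∘ₗ α) := by
  refine ⟨fun x y => ?_, fun x y z => ?_⟩
  · simp only [LinearMap.comp_apply, hαβ, h.1, hμ]
  · simp only [LinearMap.comp_apply, ← hμ, h.2]

theorem IsHomCoassociative.twist (h : IsHomCoassociative Δ α)
    (hαβ : ∀ x, α (β x) = β (α x)) (hΔ : ∀ a, Δ (β a) = map β β (Δ a)) :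
    IsHomCoassociative (Δ ∘ₗ β) (β ∘ₗ α) := by
  have left (t : A ⊗[k] A) : map (β ∘ₗ α) (Δ ∘ₗ β) (map β β t) =
      map (β ∘ₗ β) (map (β ∘ₗ β) (β ∘ₗ β)) (map α Δ t) := by
    induction t with
    | zero => simp
    | add x y hx hy => simp only [map_add, hx, hy]
    | tmul x y => simp only [map_tmul, LinearMap.comp_apply, hαβ, hΔ, map_comp]
  have right (t : A ⊗[k] A) : map (Δ ∘ₗ β) (β ∘ₗ α) (map β β t) =
      map (map (β ∘ₗ β) (β ∘ₗ β)) (β ∘ₗ β) (map Δ α t) := by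
    induction t with
    | zero => simp
    | add x y hx hy => simp only [map_add, hx, hy]
    | tmul x y => simp only [map_tmul, LinearMap.comp_apply, hαβ, hΔ, map_comp]
  refine ⟨fun a => ?_, fun a => ?_⟩
  · simp only [LinearMap.comp_apply, map_comp, ← h.1, ← hΔ, hαβ]
  · simp only [LinearMap.comp_apply Δ, hΔ]
    rw [left, right, h.2, map_map_assoc]

theorem IsCocycle.twist (h : IsCocycle μ Δ α)
    (hαβ : ∀ x, α (β x) = β (α x)) (hμ : ∀ x y, β (μ (x ⊗ₜ y)) = μ (β x ⊗ₜ β y))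
    (hΔ : ∀ a, Δ (β a) = map β β (Δ a)) :
    IsCocycle (β ∘ₗ μ) (Δ ∘ₗ β) (β ∘ₗ α) := by
  have left (a : A) (t : A ⊗[k] A) :
      map (β ∘ₗ μ) (β ∘ₗ α) ((TensorProduct.assoc k A A A).symm (β a ⊗ₜ map β β t)) =
        map β β (map β β (map μ α ((TensorProduct.assoc k A A A).symm (a ⊗ₜ t)))) := by
    induction t with
    | zero => simp
    | add x y hx hy => simp only [map_add, tmul_add, hx, hy]
    | tmul x y => simp only [map_tmul, assoc_symm_tmul, LinearMap.comp_apply, hαβ, hμ]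
  have right (t : A ⊗[k] A) (b : A) :
      map (β ∘ₗ α) (β ∘ₗ μ) (TensorProduct.assoc k A A A (map β β t ⊗ₜ β b)) =
        map β β (map β β (map α μ (TensorProduct.assoc k A A A (t ⊗ₜ b)))) := by
    induction t with
    | zero => simp
    | add x y hx hy => simp only [map_add, add_tmul, hx, hy]
    | tmul x y => simp only [map_tmul, assoc_tmul, LinearMap.comp_apply, hαβ, hμ]
  intro a b
  rw [LinearMap.comp_apply, LinearMap.comp_apply, hΔ, hΔ, h, map_add, map_add]
  simp only [LinearMap.comp_apply Δ, LinearMap.comp_apply β α, hΔ, left, right]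

/-- Twisting a coboundary infinitesimal Hom-bialgebra by an endomorphism `β` that fixes `r`. -/
theorem IsCoboundary.twist {r : A ⊗[k] A} (h : IsCoboundary μ Δ α r)
    (hαβ : ∀ x, α (β x) = β (α x)) (hμ : ∀ x y, β (μ (x ⊗ₜ y)) = μ (β x ⊗ₜ β y))
    (hΔ : ∀ a, Δ (β a) = map β β (Δ a)) (hr : map β β r = r) :
    IsCoboundary (β ∘ₗ μ) (Δ ∘ₗ β) (β ∘ₗ α) r := by
  obtain ⟨⟨hassoc, hcoassoc, hcocycle⟩, hαr, hbracket⟩ := h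
  refine ⟨⟨hassoc.twist hαβ hμ, hcoassoc.twist hαβ hΔ, hcocycle.twist hαβ hμ hΔ⟩, ?_,
    fun a => ?_⟩
  · rw [map_comp, LinearMap.comp_apply, hαr, hr]
  · rw [LinearMap.comp_apply, hΔ, hbracket]
    simp only [starBracket, LinearMap.sub_apply, map_sub, LinearMap.comp_assoc, map_comp,
      LinearMap.comp_apply]

theorem IsCoboundary.pow_twist {r : A ⊗[k] A} (h : IsCoboundary μ Δ α r) (m : ℕ) :
    IsCoboundary ((α ^ m) ∘ₗ μ) (Δ ∘ₗ (α ^ m)) (α ^ (m + 1)) r := by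
  have hμ (x y : A) : (α ^ m) (μ (x ⊗ₜ y)) = μ ((α ^ m) x ⊗ₜ (α ^ m) y) := by
    induction m with
    | zero => rfl
    | succ m ih => simp only [pow_succ', Module.End.mul_apply, ih, h.1.1.1]
  have hpow : map (α ^ m) (α ^ m) = map α α ^ m := (TensorProduct.map_pow α α m).symm
  have hΔ (a : A) : Δ ((α ^ m) a) = map (α ^ m) (α ^ m) (Δ a) := by
    rw [hpow]
    clear hpow hμ
    induction m with
    | zero => rfl
    | succ m ih => simp only [pow_succ', Module.End.mul_apply, h.1.2.1.1, ih]
  have hr : map (α ^ m) (α ^ m) r = r := by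
    rw [hpow, Module.End.pow_apply, Function.iterate_fixed h.2.1]
  have hcomm (x : A) : α ((α ^ m) x) = (α ^ m) (α x) := by
    rw [← Module.End.mul_apply, ← Module.End.mul_apply, ← pow_succ, ← pow_succ']
  exact h.twist hcomm hμ hΔ hr

end Twisting

/-- the `n`-th derived coboundary infinitesimal Hom-bialgebra. -/
theorem stmt6 [CharZero k]
    (μ : A ⊗[k] A →ₗ[k] A) (Δ : A →ₗ[k] A ⊗[k] A) (α : A →ₗ[k] A) (r : A ⊗[k] A)
    (h : IsCoboundary μ Δ α r) (n : ℕ) :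
    IsCoboundary ((α ^ (2 ^ n - 1)) ∘ₗ μ) (Δ ∘ₗ (α ^ (2 ^ n - 1)))
      (α ^ (2 ^ n)) r := by
  have key := h.pow_twist (2 ^ n - 1)
  rwa [Nat.sub_add_cancel Nat.one_le_two_pow] at key

end
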